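/- (Barabanov) Let 𝒜 = {A_1, …, A_r} be an irreducible finite set of real m×m matrices. A real number ρ equals the joint spectral radius ρ(𝒜) if and only if there exists a norm ‖·‖ on ℝ^m such that ρ·‖x‖ = max_{1≤i≤r} ‖A_i x‖ for all x ∈ ℝ^m. -/

import Mathlib

open Matrix Filter Topology Bornology Pointwise

/-- `N` is a norm on `ℝ^m`: nonnegative, definite, absolutely homogeneous, subadditive. -/
def IsNorm {m : ℕ} (N : (Fin m → ℝ) → ℝ) : Prop :=
  (∀ x, 0 ≤ N x) ∧ (∀ x, N x = 0 → x = 0) ∧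
    (∀ (t : ℝ) (x), N (t • x) = |t| * N x) ∧ (∀ x y, N (x + y) ≤ N x + N y)

/-- `N` is a seminorm on `ℝ^m`. -/
def IsSeminorm {m : ℕ} (N : (Fin m → ℝ) → ℝ) : Prop :=
  (∀ x, 0 ≤ N x) ∧
    (∀ (t : ℝ) (x), N (t • x) = |t| * N x) ∧ (∀ x y, N (x + y) ≤ N x + N y)

/-- The family `A` is irreducible: the matrices have no common invariant subspace
other than `⊥` and `⊤`. -/
def IsIrreducibleFamily {m r : ℕ} (A : Fin r → Matrix (Fin m) (Fin m) ℝ) : Prop :=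
  ∀ W : Submodule ℝ (Fin m → ℝ), (∀ i, ∀ x ∈ W, (A i).mulVec x ∈ W) → W = ⊥ ∨ W = ⊤

/-- The operator norm of a matrix acting on `ℝ^m` (with its sup norm). -/
noncomputable def matNorm {m : ℕ} (M : Matrix (Fin m) (Fin m) ℝ) : ℝ :=
  ‖LinearMap.toContinuousLinearMap M.mulVecLin‖

/-- The joint spectral radius of the family `A`:
`limsup_n (max over words of length n of the norm of the product)^(1/n)`. -/
noncomputable def jsr {m r : ℕ} (A : Fin r → Matrix (Fin m) (Fin m) ℝ) : ℝ :=
  Filter.atTop.limsup fun n : ℕ =>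
    (⨆ w : Fin n → Fin r, matNorm (List.ofFn fun k => A (w k)).prod) ^ (1 / (n : ℝ))

/-- `maxA A N x = max_i N (A_i x)`. -/
noncomputable def maxA {m r : ℕ} (A : Fin r → Matrix (Fin m) (Fin m) ℝ)
    (N : (Fin m → ℝ) → ℝ) (x : Fin m → ℝ) : ℝ :=
  ⨆ i, N ((A i).mulVec x)

/-- `ρ⁺ = max_{x ≠ 0} (max_i N (A_i x)) / N x`. -/
noncomputable def rhoSup {m r : ℕ} (A : Fin r → Matrix (Fin m) (Fin m) ℝ)
    (N : (Fin m → ℝ) → ℝ) : ℝ :=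
  sSup ((fun x => maxA A N x / N x) '' {x | x ≠ 0})

/-- `ρ⁻ = min_{x ≠ 0} (max_i N (A_i x)) / N x`. -/
noncomputable def rhoInf {m r : ℕ} (A : Fin r → Matrix (Fin m) (Fin m) ℝ)
    (N : (Fin m → ℝ) → ℝ) : ℝ :=
  sInf ((fun x => maxA A N x / N x) '' {x | x ≠ 0})

/-- An averaging function: continuous on positives, `γ t t = t`, and strictly
between `min` and `max` off the diagonal. -/
def IsAveraging (γ : ℝ → ℝ → ℝ) : Prop :=
  ContinuousOn (fun p : ℝ × ℝ => γ p.1 p.2) {p | 0 < p.1 ∧ 0 < p.2} ∧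
    (∀ t, 0 < t → γ t t = t) ∧
    ∀ t s, 0 < t → 0 < s → t ≠ s → min t s < γ t s ∧ γ t s < max t s

/-- The max-relaxation iteration: `‖x‖_{n+1} = max (‖x‖_n, γ_n⁻¹ max_i ‖A_i x‖_n)`
where `γ_n = γ (ρ⁻_n, ρ⁺_n)`. -/
noncomputable def iterN {m r : ℕ} (A : Fin r → Matrix (Fin m) (Fin m) ℝ)
    (γ : ℝ → ℝ → ℝ) (N0 : (Fin m → ℝ) → ℝ) : ℕ → (Fin m → ℝ) → ℝ
  | 0 => N0
  | n + 1 => fun x =>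
      max (iterN A γ N0 n x)
        ((γ (rhoInf A (iterN A γ N0 n)) (rhoSup A (iterN A γ N0 n)))⁻¹ *
          maxA A (iterN A γ N0 n) x)

/-- The normalized norms `‖x‖°_n = ‖x‖_n / ‖e‖_n` of the max-relaxation iteration
(for `n = 0` this equals `‖x‖_0` since `‖e‖_0 = 1`). -/
noncomputable def iterNnorm {m r : ℕ} (A : Fin r → Matrix (Fin m) (Fin m) ℝ)
    (γ : ℝ → ℝ → ℝ) (N0 : (Fin m → ℝ) → ℝ) (e : Fin m → ℝ) (n : ℕ) :
    (Fin m → ℝ) → ℝ :=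
  fun x => iterN A γ N0 n x / iterN A γ N0 n e

/-- `e⁺(N, N') = max_{x ≠ 0} N x / N' x`. -/
noncomputable def ePlus {m : ℕ} (N N' : (Fin m → ℝ) → ℝ) : ℝ :=
  sSup ((fun x => N x / N' x) '' {x | x ≠ 0})

/-- `e⁻(N, N') = min_{x ≠ 0} N x / N' x`. -/
noncomputable def eMinus {m : ℕ} (N N' : (Fin m → ℝ) → ℝ) : ℝ :=
  sInf ((fun x => N x / N' x) '' {x | x ≠ 0})

/-- The eccentricity of the norm `N` with respect to the norm `N'`. -/
noncomputable def ecc {m : ℕ} (N N' : (Fin m → ℝ) → ℝ) : ℝ :=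
  ePlus N N' / eMinus N N'

namespace IsSeminorm

variable {m r : ℕ} {N : (Fin m → ℝ) → ℝ}

lemma map_zero (h : IsSeminorm N) : N 0 = 0 := by
  simpa using h.2.1 0 0

lemma const_mul (h : IsSeminorm N) {a : ℝ} (ha : 0 ≤ a) : IsSeminorm fun x => a * N x := by
  refine ⟨fun x => mul_nonneg ha (h.1 x), fun t x => ?_, fun x y => ?_⟩
  · simp only [h.2.1 t x]; ring
  · simp only
    nlinarith [h.2.2 x y]

lemma comp_mulVec (h : IsSeminorm N) (M : Matrix (Fin m) (Fin m) ℝ) :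
    IsSeminorm fun x => N (M *ᵥ x) := by
  refine ⟨fun x => h.1 _, fun t x => ?_, fun x y => ?_⟩
  · simp only [Matrix.mulVec_smul, h.2.1]
  · simp only [Matrix.mulVec_add]
    exact h.2.2 _ _

lemma iSup {ι : Type*} [Finite ι] [Nonempty ι] {F : ι → (Fin m → ℝ) → ℝ}
    (h : ∀ i, IsSeminorm (F i)) : IsSeminorm fun x => ⨆ i, F i x := by
  refine ⟨fun x => Real.iSup_nonneg fun i => (h i).1 x, fun t x => ?_, fun x y => ?_⟩
  · simp only [(h _).2.1, Real.mul_iSup_of_nonneg (abs_nonneg t)]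
  · refine ciSup_le fun i => ((h i).2.2 x y).trans ?_
    exact add_le_add (le_ciSup (f := fun i => F i x) (Set.finite_range _).bddAbove i)
      (le_ciSup (f := fun i => F i y) (Set.finite_range _).bddAbove i)

lemma maxA [NeZero r] (h : IsSeminorm N) (A : Fin r → Matrix (Fin m) (Fin m) ℝ) :
    IsSeminorm (maxA A N) :=
  IsSeminorm.iSup fun i => h.comp_mulVec (A i)

lemma of_tendsto {F : ℕ → (Fin m → ℝ) → ℝ} (h : ∀ n, IsSeminorm (F n))
    (hF : ∀ x, Tendsto (fun n => F n x) atTop (𝓝 (N x))) : IsSeminorm N := by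
  refine ⟨fun x => ge_of_tendsto' (hF x) fun n => (h n).1 x, fun t x => ?_, fun x y => ?_⟩
  · refine tendsto_nhds_unique (hF _) ?_
    simpa only [(h _).2.1] using (hF x).const_mul |t|
  · exact le_of_tendsto_of_tendsto' (hF _) ((hF x).add (hF y)) fun n => (h n).2.2 x y

lemma map_sum_le (h : IsSeminorm N) {ι : Type*} (s : Finset ι) (f : ι → Fin m → ℝ) :
    N (∑ i ∈ s, f i) ≤ ∑ i ∈ s, N (f i) := by
  classical
  induction s using Finset.induction_on with
  | empty => simp [h.map_zero]
  | insert a s ha ih =>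
    rw [Finset.sum_insert ha, Finset.sum_insert ha]
    exact (h.2.2 _ _).trans (by gcongr)

lemma le_norm_mul_sum (h : IsSeminorm N) (x : Fin m → ℝ) :
    N x ≤ ‖x‖ * ∑ j, N (Pi.single j 1) := by
  calc N x = N (∑ j, x j • Pi.single j (1 : ℝ)) := by
        congr 1
        ext k
        simp [Finset.sum_apply, Pi.single_apply]
    _ ≤ ∑ j, N (x j • Pi.single j (1 : ℝ)) := h.map_sum_le _ _
    _ ≤ ∑ j, ‖x‖ * N (Pi.single j 1) := by
        refine Finset.sum_le_sum fun j _ => ?_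
        rw [h.2.1]
        exact mul_le_mul_of_nonneg_right (norm_le_pi_norm x j) (h.1 _)
    _ = _ := by rw [Finset.mul_sum]

lemma eq_zero_of_sum_eq_zero (h : IsSeminorm N) (hs : ∑ j, N (Pi.single j 1) = 0)
    (x : Fin m → ℝ) : N x = 0 :=
  le_antisymm (by simpa [hs] using h.le_norm_mul_sum x) (h.1 x)

lemma continuous (h : IsSeminorm N) : Continuous N := by
  refine (LipschitzWith.of_le_add_mul (∑ j, N (Pi.single j 1)).toNNReal fun x y => ?_).continuous
  rw [Real.coe_toNNReal _ (Finset.sum_nonneg fun j _ => h.1 _), dist_eq_norm, mul_comm]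
  calc N x = N (y + (x - y)) := by congr 1; abel
    _ ≤ N y + N (x - y) := h.2.2 _ _
    _ ≤ _ := by gcongr; exact h.le_norm_mul_sum _

/-- A nonzero seminorm that no matrix of an irreducible family increases by more than a
constant factor is a norm. -/
lemma isNorm_of_irreducible {A : Fin r → Matrix (Fin m) (Fin m) ℝ}
    (hA : IsIrreducibleFamily A) (h : IsSeminorm N) {t : ℝ}
    (hN : ∀ i x, N (A i *ᵥ x) ≤ t * N x) (h0 : ∃ x, N x ≠ 0) : IsNorm N := by
  refine ⟨h.1, ?_, h.2⟩
  let W : Submodule ℝ (Fin m → ℝ) :=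
    { carrier := {x | N x = 0}
      add_mem' := fun {x y} hx hy => by
        have hx' : N x = 0 := hx
        have hy' : N y = 0 := hy
        exact le_antisymm (by simpa [hx', hy'] using h.2.2 x y) (h.1 _)
      zero_mem' := h.map_zero
      smul_mem' := fun c x hx => by
        have hx' : N x = 0 := hx
        simp [h.2.1, hx'] }
  have hW : ∀ x, x ∈ W ↔ N x = 0 := fun x => Iff.rfl
  have hinv : ∀ i, ∀ x ∈ W, A i *ᵥ x ∈ W := fun i x hx => by
    rw [hW] at hx ⊢
    exact le_antisymm (by simpa [hx] using hN i x) (h.1 _)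
  rcases hA W hinv with h1 | h1
  · intro x hx
    have : x ∈ W := hx
    simpa [h1] using this
  · obtain ⟨x, hx⟩ := h0
    exact absurd ((hW x).1 (h1 ▸ Submodule.mem_top)) hx

end IsSeminorm

section MaxOperator

variable {m r : ℕ} (A : Fin r → Matrix (Fin m) (Fin m) ℝ) {N N' : (Fin m → ℝ) → ℝ}

lemma le_maxA (N : (Fin m → ℝ) → ℝ) (i : Fin r) (x : Fin m → ℝ) :
    N (A i *ᵥ x) ≤ maxA A N x :=
  le_ciSup (f := fun i => N (A i *ᵥ x)) (Set.finite_range _).bddAbove i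

lemma exists_maxA_eq [NeZero r] (N : (Fin m → ℝ) → ℝ) (x : Fin m → ℝ) :
    ∃ i, N (A i *ᵥ x) = maxA A N x :=
  exists_eq_ciSup_of_finite

lemma maxA_mono [NeZero r] (h : ∀ x, N x ≤ N' x) (x : Fin m → ℝ) :
    maxA A N x ≤ maxA A N' x :=
  ciSup_le fun i => (h _).trans (le_maxA A N' i x)

lemma maxA_const_mul {a : ℝ} (ha : 0 ≤ a) (N : (Fin m → ℝ) → ℝ) (x : Fin m → ℝ) :
    maxA A (fun y => a * N y) x = a * maxA A N x :=
  (Real.mul_iSup_of_nonneg ha _).symm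

lemma tendsto_maxA [NeZero r] {F : ℕ → (Fin m → ℝ) → ℝ}
    (hF : ∀ x, Tendsto (fun n => F n x) atTop (𝓝 (N x))) (x : Fin m → ℝ) :
    Tendsto (fun n => maxA A (F n) x) atTop (𝓝 (maxA A N x)) := by
  have h (G : (Fin m → ℝ) → ℝ) : maxA A G x =
      Finset.univ.sup' Finset.univ_nonempty fun i => G (A i *ᵥ x) :=
    (Finset.sup'_univ_eq_ciSup _).symm
  simp only [h]
  exact Tendsto.finset_sup'_nhds_apply _ fun i _ => hF _

lemma isSeminorm_iterate [NeZero r] (h : IsSeminorm N) (n : ℕ) :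
    IsSeminorm ((maxA A)^[n] N) := by
  induction n with
  | zero => exact h
  | succ n ih => rw [Function.iterate_succ_apply']; exact ih.maxA A

end MaxOperator

lemma IsNorm.isSeminorm {m : ℕ} {N : (Fin m → ℝ) → ℝ} (h : IsNorm N) : IsSeminorm N :=
  ⟨h.1, h.2.2⟩

lemma IsNorm.exists_norm_le {m : ℕ} {N : (Fin m → ℝ) → ℝ} (h : IsNorm N) :
    ∃ K, 0 < K ∧ ∀ x, ‖x‖ ≤ K * N x := by
  rcases (Metric.sphere (0 : Fin m → ℝ) 1).eq_empty_or_nonempty with he | hne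
  · refine ⟨1, one_pos, fun x => ?_⟩
    by_cases hx : x = 0
    · simp [hx, h.1]
    · have : (‖x‖⁻¹ • x) ∈ Metric.sphere (0 : Fin m → ℝ) 1 := by
        simp [norm_smul, hx]
      simp [he] at this
  · obtain ⟨z, hz, hmin⟩ := (isCompact_sphere (0 : Fin m → ℝ) 1).exists_isMinOn hne
      h.isSeminorm.continuous.continuousOn
    have hz0 : z ≠ 0 := by rintro rfl; simp at hz
    have hpos : 0 < N z := lt_of_le_of_ne (h.1 z) fun h' => hz0 (h.2.1 z h'.symm)
    refine ⟨(N z)⁻¹, inv_pos.2 hpos, fun x => ?_⟩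
    by_cases hx : x = 0
    · simp [hx, h.isSeminorm.map_zero]
    · have hx' : 0 < ‖x‖ := norm_pos_iff.2 hx
      have hmem : (‖x‖⁻¹ • x) ∈ Metric.sphere (0 : Fin m → ℝ) 1 := by
        simp [norm_smul, hx]
      have := isMinOn_iff.1 hmin _ hmem
      rw [h.2.2.1, abs_of_pos (inv_pos.2 hx'), inv_mul_eq_div, le_div_iff₀ hx'] at this
      rwa [inv_mul_eq_div, le_div_iff₀ hpos, mul_comm]

section Existence

variable {m r : ℕ}

/-- The seminorms normalized on the standard basis, together with a bound on the growth factor of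
the family `A`. -/
def growthPairs (A : Fin r → Matrix (Fin m) (Fin m) ℝ) : Set (ℝ × ((Fin m → ℝ) → ℝ)) :=
  {p | 0 ≤ p.1 ∧ IsSeminorm p.2 ∧ ∑ j, p.2 (Pi.single j 1) = 1 ∧
    ∀ i x, p.2 (A i *ᵥ x) ≤ p.1 * p.2 x}

lemma isClosed_growthPairs (A : Fin r → Matrix (Fin m) (Fin m) ℝ) :
    IsClosed (growthPairs A) := by
  simp only [growthPairs, IsSeminorm, Set.ofPred_and, Set.ofPred_forall]
  refine (isClosed_le (by fun_prop) (by fun_prop)).inter (((isClosed_iInter fun x =>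
    isClosed_le (by fun_prop) (by fun_prop)).inter ((isClosed_iInter fun t =>
    isClosed_iInter fun x => isClosed_eq (by fun_prop) (by fun_prop)).inter
    (isClosed_iInter fun x => isClosed_iInter fun y =>
      isClosed_le (by fun_prop) (by fun_prop)))).inter
    ((isClosed_eq (by fun_prop) (by fun_prop)).inter
    (isClosed_iInter fun i => isClosed_iInter fun x =>
      isClosed_le (by fun_prop) (by fun_prop))))

lemma mem_growthPairs_normalize {A : Fin r → Matrix (Fin m) (Fin m) ℝ} {t : ℝ} (ht : 0 ≤ t)
    {N : (Fin m → ℝ) → ℝ} (h : IsSeminorm N) (hN : ∀ i x, N (A i *ᵥ x) ≤ t * N x)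
    (hs : 0 < ∑ j, N (Pi.single j 1)) :
    (t, fun x => (∑ j, N (Pi.single j 1))⁻¹ * N x) ∈ growthPairs A := by
  refine ⟨ht, h.const_mul (inv_nonneg.2 hs.le), ?_, fun i x => ?_⟩
  · simp only [← Finset.mul_sum]
    exact inv_mul_cancel₀ hs.ne'
  · calc _ ≤ (∑ j, N (Pi.single j 1))⁻¹ * (t * N x) :=
          mul_le_mul_of_nonneg_left (hN i x) (inv_nonneg.2 hs.le)
      _ = _ := by simp only; ring

lemma growthPairs_nonempty [NeZero r] (hm : 0 < m) (A : Fin r → Matrix (Fin m) (Fin m) ℝ) :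
    (growthPairs A).Nonempty := by
  have hn : IsSeminorm fun x : Fin m → ℝ => ‖x‖ :=
    ⟨norm_nonneg, fun t x => by simp [norm_smul], norm_add_le⟩
  have ht := hn.maxA A
  refine ⟨_, mem_growthPairs_normalize (t := ∑ j, maxA A (fun y => ‖y‖) (Pi.single j 1))
    (Finset.sum_nonneg fun j _ => ht.1 _) hn (fun i x => ?_) ?_⟩
  · rw [mul_comm]
    exact (le_maxA A (fun y => ‖y‖) i x).trans (ht.le_norm_mul_sum x)
  · simp [Pi.norm_single, hm]

/-- The smallest growth factor is attained. -/
lemma exists_min_growthPairs [NeZero r] (hm : 0 < m) (A : Fin r → Matrix (Fin m) (Fin m) ℝ) :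
    ∃ p ∈ growthPairs A, ∀ q ∈ growthPairs A, p.1 ≤ q.1 := by
  obtain ⟨p₀, hp₀⟩ := growthPairs_nonempty hm A
  have hK : IsCompact ((Set.Icc 0 p₀.1 ×ˢ Set.univ.pi fun x : Fin m → ℝ => Set.Icc 0 ‖x‖) ∩
      growthPairs A) :=
    (isCompact_Icc.prod (isCompact_univ_pi fun _ => isCompact_Icc)).inter_right
      (isClosed_growthPairs A)
  have hmem : ∀ q ∈ growthPairs A, q.1 ≤ p₀.1 →
      q ∈ (Set.Icc 0 p₀.1 ×ˢ Set.univ.pi fun x : Fin m → ℝ => Set.Icc 0 ‖x‖) ∩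
        growthPairs A := by
    refine fun q hq hle => ⟨⟨⟨hq.1, hle⟩, fun x _ => ⟨hq.2.1.1 x, ?_⟩⟩, hq⟩
    simpa [hq.2.2.1] using hq.2.1.le_norm_mul_sum x
  obtain ⟨p, hp, hmin⟩ := hK.exists_isMinOn ⟨p₀, hmem p₀ hp₀ le_rfl⟩ continuous_fst.continuousOn
  refine ⟨p, hp.2, fun q hq => ?_⟩
  rcases le_total q.1 p₀.1 with hle | hle
  · exact isMinOn_iff.1 hmin q (hmem q hq hle)
  · exact hp.1.1.2.trans hle

/-- If the `n`-th iterate of the max operator contracts `N` by `s ^ n`, then some seminorm above `N`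
has growth factor `s`. -/
lemma exists_growth_le_of_iterate_le [NeZero r] (A : Fin r → Matrix (Fin m) (Fin m) ℝ)
    {N : (Fin m → ℝ) → ℝ} (h : IsSeminorm N) {s : ℝ} (hs : 0 < s) {n : ℕ} (hn : n ≠ 0)
    (hN : ∀ x, (maxA A)^[n] N x ≤ s ^ n * N x) :
    ∃ N', IsSeminorm N' ∧ (∀ x, N x ≤ N' x) ∧ ∀ i x, N' (A i *ᵥ x) ≤ s * N' x := by
  have : NeZero n := ⟨hn⟩
  let F : Fin n → (Fin m → ℝ) → ℝ := fun k x => (s ^ (k : ℕ))⁻¹ * (maxA A)^[k] N x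
  have hle (k : Fin n) (x) : F k x ≤ ⨆ k, F k x :=
    le_ciSup (f := fun k => F k x) (Set.finite_range _).bddAbove k
  refine ⟨fun x => ⨆ k, F k x, IsSeminorm.iSup fun k =>
    (isSeminorm_iterate A h k).const_mul (by positivity), fun x => ?_, fun i x => ?_⟩
  · simpa [F] using hle 0 x
  · refine ciSup_le fun k => ?_
    have h1 : F k (A i *ᵥ x) ≤ (s ^ (k : ℕ))⁻¹ * (maxA A)^[k + 1] N x := by
      rw [Function.iterate_succ_apply']
      exact mul_le_mul_of_nonneg_left (le_maxA A _ i x) (by positivity)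
    refine h1.trans ?_
    have h2 : (s ^ (k : ℕ))⁻¹ * (maxA A)^[k + 1] N x =
        s * ((s ^ ((k : ℕ) + 1))⁻¹ * (maxA A)^[k + 1] N x) := by
      rw [pow_succ]
      field_simp
    rw [h2]
    refine mul_le_mul_of_nonneg_left ?_ hs.le
    by_cases hk : (k : ℕ) + 1 < n
    · exact hle ⟨k + 1, hk⟩ x
    · have hk' : (k : ℕ) + 1 = n := by omega
      rw [hk', inv_mul_le_iff₀ (by positivity)]
      refine (hN x).trans (mul_le_mul_of_nonneg_left ?_ (by positivity))
      simpa [F] using hle 0 x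

/-- An irreducible family in dimension at least two contains a nonzero matrix. -/
lemma IsIrreducibleFamily.exists_mulVec_ne_zero (hm : 2 ≤ m)
    {A : Fin r → Matrix (Fin m) (Fin m) ℝ} (hA : IsIrreducibleFamily A) :
    ∃ i x, A i *ᵥ x ≠ 0 := by
  by_contra! h
  let e : Fin m → ℝ := Pi.single ⟨0, by omega⟩ 1
  have he : e ≠ 0 := by simp [e]
  rcases hA (Submodule.span ℝ {e}) fun i x _ => by simp [h i x] with h1 | h1
  · exact he (Submodule.span_singleton_eq_bot.1 h1)
  · have h2 := finrank_span_singleton (K := ℝ) he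
    rw [h1, finrank_top, Module.finrank_fin_fun] at h2
    omega

theorem exists_barabanov_norm [NeZero r] (hm : 2 ≤ m) {A : Fin r → Matrix (Fin m) (Fin m) ℝ}
    (hA : IsIrreducibleFamily A) :
    ∃ (ρ : ℝ) (N : (Fin m → ℝ) → ℝ), IsNorm N ∧ ∀ x, ρ * N x = maxA A N x := by
  obtain ⟨⟨ρ, N⟩, ⟨hρ0, hN, hsum, hgrow⟩, hmin⟩ := exists_min_growthPairs (by omega) A
  simp only at hρ0 hN hsum hgrow hmin
  have hNnorm : IsNorm N := hN.isNorm_of_irreducible hA hgrow (by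
    by_contra! h
    simp [h] at hsum)
  have hρ : 0 < ρ := by
    refine lt_of_le_of_ne hρ0 fun h => ?_
    obtain ⟨i, x, hx⟩ := hA.exists_mulVec_ne_zero hm
    exact hx (hNnorm.2.1 _ (le_antisymm (by simpa [← h] using hgrow i x) (hN.1 _)))
  let F : ℕ → (Fin m → ℝ) → ℝ := fun n x => (ρ ^ n)⁻¹ * (maxA A)^[n] N x
  have hF (n) : IsSeminorm (F n) := (isSeminorm_iterate A hN n).const_mul (by positivity)
  have hstep (n x) : maxA A (F n) x = ρ * F (n + 1) x := by
    simp only [F]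
    rw [maxA_const_mul A (by positivity), Function.iterate_succ_apply', pow_succ]
    field_simp
  have hanti (n : ℕ) : ∀ x, F (n + 1) x ≤ F n x := by
    induction n with
    | zero =>
      intro x
      have h1 : maxA A N x ≤ ρ * N x := ciSup_le fun i => hgrow i x
      simpa [F, inv_mul_le_iff₀ hρ] using h1
    | succ n ih =>
      intro x
      have h1 := maxA_mono A ih x
      rw [hstep, hstep] at h1
      exact le_of_mul_le_mul_left h1 hρ
  have hlim (x) : Tendsto (fun n => F n x) atTop (𝓝 (⨅ n, F n x)) :=
    tendsto_atTop_ciInf (antitone_nat_of_succ_le fun n => hanti n x)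
      ⟨0, by rintro _ ⟨n, rfl⟩; exact (hF n).1 x⟩
  have hv : IsSeminorm fun x => ⨅ n, F n x := IsSeminorm.of_tendsto hF hlim
  have hfix (x) : ρ * (⨅ n, F n x) = maxA A (fun x => ⨅ n, F n x) x := by
    refine tendsto_nhds_unique ?_ (tendsto_maxA A hlim x)
    simp only [hstep]
    exact ((tendsto_add_atTop_iff_nat 1).2 (hlim x)).const_mul ρ
  refine ⟨ρ, _, hv.isNorm_of_irreducible hA (t := ρ) (fun i x => ?_) ?_, hfix⟩
  · rw [hfix]
    exact le_maxA A (fun x => ⨅ n, F n x) i x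
  by_contra! hzero
  obtain ⟨K, hK, hKN⟩ := hNnorm.exists_norm_le
  have hsumlim : Tendsto (fun n => ∑ j, F n (Pi.single j 1)) atTop (𝓝 0) := by
    simpa [hzero] using tendsto_finsetSum Finset.univ fun j _ => hlim (Pi.single j 1)
  obtain ⟨n, hn, hn1⟩ := ((hsumlim.eventually_lt_const
    (show (0 : ℝ) < 1 / (2 * K) by positivity)).and (eventually_ge_atTop 1)).exists
  have hn0 : n ≠ 0 := by omega
  have hhalf (x) : F n x ≤ 1 / 2 * N x := by
    calc F n x ≤ ‖x‖ * ∑ j, F n (Pi.single j 1) := (hF n).le_norm_mul_sum x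
      _ ≤ (K * N x) * (1 / (2 * K)) := mul_le_mul (hKN x) hn.le
          (Finset.sum_nonneg fun j _ => (hF n).1 _) (mul_nonneg hK.le (hN.1 x))
      _ = _ := by field_simp
  let c : ℝ := (1 / 2 : ℝ) ^ (1 / (n : ℝ))
  have hc0 : 0 < c := by positivity
  have hc1 : c < 1 := Real.rpow_lt_one (by norm_num) (by norm_num) (by positivity)
  have hcn : c ^ n = 1 / 2 := by
    simp only [c, one_div]
    exact Real.rpow_inv_natCast_pow (by norm_num) hn0
  obtain ⟨N', hN', hle, hgrow'⟩ := exists_growth_le_of_iterate_le A hN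
    (mul_pos hc0 hρ) hn0 fun x => by
      have h1 := hhalf x
      simp only [F] at h1
      rw [inv_mul_le_iff₀ (by positivity)] at h1
      rw [mul_pow, hcn]
      linarith
  have hpos : 0 < ∑ j, N' (Pi.single j 1) :=
    one_pos.trans_le (hsum.symm.trans_le (Finset.sum_le_sum fun j _ => hle _))
  have := hmin _ (mem_growthPairs_normalize (mul_pos hc0 hρ).le hN' hgrow' hpos)
  simp only at this
  nlinarith

end Existence

section JointSpectralRadius

variable {m r : ℕ}

lemma norm_mulVec_le_matNorm (M : Matrix (Fin m) (Fin m) ℝ) (x : Fin m → ℝ) :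
    ‖M *ᵥ x‖ ≤ matNorm M * ‖x‖ :=
  (LinearMap.toContinuousLinearMap M.mulVecLin).le_opNorm x

lemma matNorm_le {M : Matrix (Fin m) (Fin m) ℝ} {K : ℝ} (hK : 0 ≤ K)
    (h : ∀ x, ‖M *ᵥ x‖ ≤ K * ‖x‖) : matNorm M ≤ K :=
  ContinuousLinearMap.opNorm_le_bound _ hK h

lemma matNorm_nonneg (M : Matrix (Fin m) (Fin m) ℝ) : 0 ≤ matNorm M :=
  norm_nonneg _

variable {A : Fin r → Matrix (Fin m) (Fin m) ℝ} {N : (Fin m → ℝ) → ℝ} {ρ : ℝ}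

lemma word_le (hρ : 0 ≤ ρ) (h : ∀ x, ρ * N x = maxA A N x) (n : ℕ) (w : Fin n → Fin r)
    (x : Fin m → ℝ) : N ((List.ofFn fun k => A (w k)).prod *ᵥ x) ≤ ρ ^ n * N x := by
  induction n with
  | zero => simp
  | succ n ih =>
    rw [List.ofFn_succ, List.prod_cons, ← Matrix.mulVec_mulVec]
    refine (le_maxA A N _ _).trans ?_
    rw [← h, pow_succ', mul_assoc]
    exact mul_le_mul_of_nonneg_left (ih _) hρ

lemma exists_word_eq [NeZero r] (h : ∀ x, ρ * N x = maxA A N x) (n : ℕ) (x : Fin m → ℝ) :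
    ∃ w : Fin n → Fin r, N ((List.ofFn fun k => A (w k)).prod *ᵥ x) = ρ ^ n * N x := by
  induction n with
  | zero => simp
  | succ n ih =>
    obtain ⟨w, hw⟩ := ih
    obtain ⟨i, hi⟩ := exists_maxA_eq A N ((List.ofFn fun k => A (w k)).prod *ᵥ x)
    refine ⟨Fin.cons i w, ?_⟩
    rw [List.ofFn_succ, List.prod_cons, ← Matrix.mulVec_mulVec]
    simp only [Fin.cons_zero, Fin.cons_succ]
    rw [hi, ← h, hw, pow_succ', mul_assoc]

lemma tendsto_rpow_one_div_of_bounds {f : ℕ → ℝ} {c C : ℝ} (hc : 0 < c) (hC : 0 < C)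
    (hρ : 0 ≤ ρ) (hl : ∀ n, c * ρ ^ n ≤ f n) (hu : ∀ n, f n ≤ C * ρ ^ n) :
    Tendsto (fun n : ℕ => f n ^ (1 / (n : ℝ))) atTop (𝓝 ρ) := by
  have hlim {a : ℝ} (ha : 0 < a) :
      Tendsto (fun n : ℕ => (a * ρ ^ n) ^ (1 / (n : ℝ))) atTop (𝓝 ρ) := by
    have h1 : Tendsto (fun n : ℕ => a ^ (1 / (n : ℝ)) * ρ) atTop (𝓝 ρ) := by
      simpa using ((Real.continuousAt_const_rpow ha.ne').tendsto.comp
        (tendsto_one_div_atTop_nhds_zero_nat (𝕜 := ℝ))).mul_const ρ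
    refine h1.congr' ?_
    filter_upwards [eventually_ne_atTop 0] with n hn
    rw [Real.mul_rpow ha.le (by positivity), one_div, Real.pow_rpow_inv_natCast hρ hn]
  refine tendsto_of_tendsto_of_tendsto_of_le_of_le (hlim hc) (hlim hC) (fun n => ?_) fun n => ?_
  · exact Real.rpow_le_rpow (by positivity) (hl n) (by positivity)
  · exact Real.rpow_le_rpow ((by positivity : 0 ≤ c * ρ ^ n).trans (hl n)) (hu n) (by positivity)

theorem eq_jsr_of_barabanov_norm [NeZero r] (hm : 0 < m) (hN : IsNorm N)
    (h : ∀ x, ρ * N x = maxA A N x) : ρ = jsr A := by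
  obtain ⟨K, hK, hKN⟩ := hN.exists_norm_le
  have hS := hN.isSeminorm
  let e : Fin m → ℝ := Pi.single ⟨0, hm⟩ 1
  have he : N e ≠ 0 := fun h0 => by
    have := hN.2.1 e h0
    simp [e] at this
  have hepos : 0 < N e := lt_of_le_of_ne (hN.1 e) he.symm
  have hene : 0 < ‖e‖ := by simp [e, Pi.norm_single]
  have hρ : 0 ≤ ρ := nonneg_of_mul_nonneg_left ((h e).symm ▸ (hS.maxA A).1 e) hepos
  set C : ℝ := ∑ j, N (Pi.single j 1) with hCdef
  have hC : 0 < C := pos_of_mul_pos_right (hepos.trans_le (hS.le_norm_mul_sum e)) hene.le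
  refine (tendsto_rpow_one_div_of_bounds (c := N e / (C * ‖e‖)) (C := K * C)
    (by positivity) (by positivity) hρ (fun n => ?_) fun n => ?_).limsup_eq.symm
  · obtain ⟨w, hw⟩ := exists_word_eq h n e
    refine le_trans ?_ (le_ciSup (Set.finite_range _).bddAbove w)
    rw [div_mul_eq_mul_div, div_le_iff₀ (by positivity), mul_comm (N e), ← hw]
    calc _ ≤ _ := hS.le_norm_mul_sum _
      _ ≤ (matNorm (List.ofFn fun k => A (w k)).prod * ‖e‖) * C := by
          gcongr
          exact norm_mulVec_le_matNorm _ _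
      _ = _ := by ring
  · refine ciSup_le fun w => matNorm_le (by positivity) fun x => ?_
    calc _ ≤ K * N ((List.ofFn fun k => A (w k)).prod *ᵥ x) := hKN _
      _ ≤ K * (ρ ^ n * (‖x‖ * C)) := by
          gcongr
          exact (word_le hρ h n w x).trans (by gcongr; exact hS.le_norm_mul_sum x)
      _ = _ := by ring

end JointSpectralRadius

/-- Barabanov: for an irreducible family, `ρ = ρ(𝒜)` iff there is a norm
`‖·‖` with `ρ ‖x‖ = max_i ‖A_i x‖` for all `x`. -/
theorem stmt3 {m r : ℕ} (hm : 2 ≤ m) (hr : 1 ≤ r)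
    (A : Fin r → Matrix (Fin m) (Fin m) ℝ) (hA : IsIrreducibleFamily A) (ρ : ℝ) :
    ρ = jsr A ↔ ∃ N : (Fin m → ℝ) → ℝ, IsNorm N ∧ ∀ x, ρ * N x = maxA A N x := by
  have : NeZero r := ⟨by omega⟩
  constructor
  · rintro rfl
    obtain ⟨ρ, N, hN, h⟩ := exists_barabanov_norm hm hA
    exact ⟨N, hN, eq_jsr_of_barabanov_norm (by omega) hN h ▸ h⟩
  · rintro ⟨N, hN, h⟩
    exact eq_jsr_of_barabanov_norm (by omega) hN h
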